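/- Let p be an arrangement on the order-3 permutohedron with exactly m nonzero values, where 1 < m ≤ 6, and suppose the nonzero values of p are pairwise distinct. Then the number of permutations g ∈ Equiv.Perm (Fin 6) such that ⟨d⟩(p ∘ g) equals the minimum of ⟨d⟩(p ∘ h) over all h ∈ Equiv.Perm (Fin 6) is exactly 12 * (6 - m)!. -/

import Mathlib

noncomputable section
open scoped Classical

/-- swap distance on the order-3 permutohedron (the 6-cycle on `Fin 6`) -/
def dd (i j : Fin 6) : ℕ := min ((i.val + 6 - j.val) % 6) ((j.val + 6 - i.val) % 6)

/-- average swap distance -/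
def avgd (p : Fin 6 → ℝ) : ℝ := ∑ i, ∑ j, p i * p j * (dd i j : ℝ)

/-- The dihedral symmetries of the 6-cycle: rotations `x ↦ k + x` and reflections `x ↦ k - x`. -/
def dihedral (r : Bool × Fin 6) : Equiv.Perm (Fin 6) :=
  if r.1 then Equiv.addLeft r.2 else Equiv.subLeft r.2

/-- The organ-pipe ordering of the vertices: `organPipe n` is the vertex that carries the value
of rank `n`. -/
def organPipe : Equiv.Perm (Fin 6) where
  toFun := ![0, 1, 5, 2, 4, 3]
  invFun := ![0, 1, 3, 5, 4, 2]
  left_inv := by decide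
  right_inv := by decide

lemma dd_dihedral (r : Bool × Fin 6) (i j : Fin 6) :
    dd (dihedral r i) (dihedral r j) = dd i j := by
  revert r i j
  decide

lemma dihedral_eq_of_apply_organPipe (r s : Bool × Fin 6)
    (h₀ : dihedral r (organPipe 0) = dihedral s (organPipe 0))
    (h₁ : dihedral r (organPipe 1) = dihedral s (organPipe 1)) : r = s := by
  revert r s
  decide

lemma avgd_comp_dihedral (f : Fin 6 → ℝ) (r : Bool × Fin 6) :
    avgd (f ∘ dihedral r) = avgd f := by
  unfold avgd
  rw [← Equiv.sum_comp (dihedral r) (fun i => ∑ j, f i * f j * (dd i j : ℝ))]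
  refine Finset.sum_congr rfl fun i _ => ?_
  rw [← Equiv.sum_comp (dihedral r) (fun j => f (dihedral r i) * f j * (dd (dihedral r i) j : ℝ))]
  simp only [dd_dihedral, Function.comp_apply]

lemma avgd_eq (f : Fin 6 → ℝ) : avgd f =
    2 * ((f 0 * f 1 + f 1 * f 2 + f 2 * f 3 + f 3 * f 4 + f 4 * f 5 + f 5 * f 0)
      + 2 * (f 0 * f 2 + f 1 * f 3 + f 2 * f 4 + f 3 * f 5 + f 4 * f 0 + f 5 * f 1)
      + 3 * (f 0 * f 3 + f 1 * f 4 + f 2 * f 5)) := by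
  have h : (min 2 4 : ℝ) = 2 ∧ (min 4 2 : ℝ) = 2 := by norm_num
  simp [avgd, Fin.sum_univ_six, dd, h]
  ring

lemma nonneg_of_polarized {a b c : ℝ} (ha : 0 < a) (hab : 0 ≤ b * (a + c))
    (hac : 0 ≤ c * (a + b)) (hbc : 0 ≤ a * (b + c)) : 0 ≤ b ∧ 0 ≤ c := by
  have h : 0 ≤ b + c := nonneg_of_mul_nonneg_right hbc ha
  constructor
  · by_contra! hb
    nlinarith [mul_pos_of_neg_of_neg hb (neg_lt_zero.mpr (by linarith : 0 < a + c))]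
  · by_contra! hc
    nlinarith [mul_pos_of_neg_of_neg hc (neg_lt_zero.mpr (by linarith : 0 < a + b))]

/-- A minimal arrangement with its largest value at `0` and `f 5 ≤ f 1` is an organ pipe. -/
lemma antitone_comp_organPipe {f : Fin 6 → ℝ} (hf : ∀ i, 0 ≤ f i)
    (hinj : ∀ i j, f i ≠ 0 → f j ≠ 0 → i ≠ j → f i ≠ f j)
    (hmin : ∀ σ : Equiv.Perm (Fin 6), avgd f ≤ avgd (f ∘ σ))
    (h0 : 0 < f 0) (hmax : ∀ i, f i ≤ f 0) (h51 : f 5 ≤ f 1) :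
    Antitone (f ∘ organPipe) := by
  have hlt : ∀ i, i ≠ 0 → f i < f 0 := fun i hi => by
    refine lt_of_le_of_ne (hmax i) fun h => ?_
    exact hinj i 0 (h ▸ h0.ne') h0.ne' hi h
  have hm : ∀ g : Fin 6 → Fin 6, Function.Bijective g → avgd f ≤ avgd (f ∘ g) :=
    fun g hg => hmin (Equiv.ofBijective g hg)
  obtain ⟨h41, h32⟩ : 0 ≤ f 1 - f 4 ∧ 0 ≤ f 2 - f 3 := by
    refine nonneg_of_polarized (sub_pos.mpr (hlt 5 (by decide))) ?_ ?_ ?_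
    · have := hm ![0, 4, 2, 3, 1, 5] (by decide)
      simp [avgd_eq] at this
      linarith
    · have := hm ![0, 1, 3, 2, 4, 5] (by decide)
      simp [avgd_eq] at this
      linarith
    · have := hm ![5, 1, 2, 3, 4, 0] (by decide)
      simp [avgd_eq] at this
      linarith
  obtain ⟨h25, h34⟩ : 0 ≤ f 5 - f 2 ∧ 0 ≤ f 4 - f 3 := by
    refine nonneg_of_polarized (sub_pos.mpr (hlt 1 (by decide))) ?_ ?_ ?_
    · have := hm ![0, 1, 5, 3, 4, 2] (by decide)
      simp [avgd_eq] at this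
      linarith
    · have := hm ![0, 1, 2, 4, 3, 5] (by decide)
      simp [avgd_eq] at this
      linarith
    · have := hm ![1, 0, 2, 3, 4, 5] (by decide)
      simp [avgd_eq] at this
      linarith
  obtain ⟨h21, h45⟩ : 0 ≤ f 1 - f 2 ∧ 0 ≤ f 5 - f 4 := by
    refine nonneg_of_polarized (sub_pos.mpr (hlt 3 (by decide))) ?_ ?_ ?_
    · have := hm ![0, 2, 1, 3, 4, 5] (by decide)
      simp [avgd_eq] at this
      linarith
    · have := hm ![0, 1, 2, 3, 5, 4] (by decide)
      simp [avgd_eq] at this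
      linarith
    · have := hm ![3, 1, 2, 0, 4, 5] (by decide)
      simp [avgd_eq] at this
      linarith
  have h42 : f 4 ≤ f 2 := by
    rcases h51.lt_or_eq with h | h
    · have := hm ![0, 1, 4, 3, 2, 5] (by decide)
      simp [avgd_eq] at this
      have h' : 0 ≤ (f 1 - f 5) * (f 2 - f 4) := by linarith
      linarith [nonneg_of_mul_nonneg_right h' (sub_pos.mpr h)]
    · have h5 : f 5 = 0 := by
        by_contra hne
        exact hinj 5 1 hne (h ▸ hne) (by decide) h
      linarith [hf 2]
  have h10 := hmax 1
  refine Fin.antitone_iff_succ_le.mpr fun i => ?_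
  fin_cases i <;> simp [organPipe] <;> linarith

/-- Permutations under which a tuple with distinct nonzero values is invariant permute its zeros. -/
lemma card_comp_eq_self {p : Fin 6 → ℝ}
    (hinj : ∀ i j, p i ≠ 0 → p j ≠ 0 → i ≠ j → p i ≠ p j) :
    (Finset.univ.filter fun g : Equiv.Perm (Fin 6) => p ∘ g = p).card
      = Nat.factorial (6 - (Finset.univ.filter fun i => p i ≠ 0).card) := by
  have hiff : ∀ g : Equiv.Perm (Fin 6), p ∘ g = p ↔ ∀ i, ¬ p i = 0 → g i = i := by
    refine fun g => ⟨fun h i hi => ?_, fun h => funext fun i => ?_⟩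
    · have hgi : p (g i) = p i := congrFun h i
      by_contra hne
      exact hinj (g i) i (hgi ▸ hi) hi hne hgi
    · by_cases hi : p i = 0
      · have hgi : p (g i) = 0 := by
          by_contra hne
          exact hne (by rw [g.injective (h _ hne), hi])
        rw [Function.comp_apply, hgi, hi]
      · rw [Function.comp_apply, h i hi]
  rw [Finset.filter_congr fun g _ => hiff g, ← Fintype.card_subtype,
    ← Fintype.card_congr (Equiv.Perm.subtypeEquivSubtypePerm fun i => p i = 0),
    Fintype.card_perm, Fintype.card_subtype]
  have := Finset.card_filter_add_card_filter_not (s := Finset.univ) fun i => p i = 0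
  rw [Finset.card_univ, Fintype.card_fin] at this
  congr 1
  exact Nat.eq_sub_of_add_eq this

lemma card_antitone_comp {p : Fin 6 → ℝ}
    (hinj : ∀ i j, p i ≠ 0 → p j ≠ 0 → i ≠ j → p i ≠ p j) :
    (Finset.univ.filter fun g : Equiv.Perm (Fin 6) => Antitone (p ∘ g)).card
      = Nat.factorial (6 - (Finset.univ.filter fun i => p i ≠ 0).card) := by
  rw [← card_comp_eq_self hinj]
  have hτ : Antitone (p ∘ Tuple.sort (OrderDual.toDual ∘ p)) :=
    fun _ _ hij => Tuple.monotone_sort (OrderDual.toDual ∘ p) hij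
  set τ := Tuple.sort (OrderDual.toDual ∘ p)
  refine Finset.card_equiv (Equiv.mulRight τ⁻¹) fun g => ?_
  simp only [Finset.mem_filter, Finset.mem_univ, true_and, Equiv.coe_mulRight]
  constructor
  · intro hg
    funext i
    simpa using congrFun (Tuple.unique_antitone hg hτ) (τ⁻¹ i)
  · intro hg
    convert hτ using 1
    funext i
    simpa using congrFun hg (τ i)

/-- with `1 < m ≤ 6` pairwise-distinct nonzero values, exactly
`2 · 6 · (6 - m)! = 12 (6 - m)!` permutations achieve the minimum of
`⟨d⟩(p ∘ g)`. -/
theorem stmt_16 (p : Fin 6 → ℝ) (hp0 : ∀ i, 0 ≤ p i) (hp1 : ∑ i, p i = 1)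
    (m : ℕ) (hm : m = (Finset.univ.filter (fun i => p i ≠ 0)).card)
    (hm1 : 1 < m) (hm6 : m ≤ 6)
    (hdist : ∀ i j : Fin 6, p i ≠ 0 → p j ≠ 0 → i ≠ j → p i ≠ p j) :
    (Finset.univ.filter (fun g : Equiv.Perm (Fin 6) =>
        avgd (p ∘ ⇑g) =
          Finset.univ.inf' Finset.univ_nonempty
            (fun h : Equiv.Perm (Fin 6) => avgd (p ∘ ⇑h)))).card
      = 12 * Nat.factorial (6 - m) := by
  have hpos : ∃ i, 0 < p i := by
    by_contra! h
    linarith [Finset.sum_nonpos fun i (_ : i ∈ Finset.univ) => h i]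
  have mem_iff : ∀ g : Equiv.Perm (Fin 6), (avgd (p ∘ g) =
      Finset.univ.inf' Finset.univ_nonempty fun h : Equiv.Perm (Fin 6) => avgd (p ∘ h)) ↔
      ∀ h : Equiv.Perm (Fin 6), avgd (p ∘ g) ≤ avgd (p ∘ h) := by
    refine fun g => ⟨fun hg h => hg ▸ Finset.inf'_le _ (Finset.mem_univ h), fun hg => ?_⟩
    exact le_antisymm (Finset.le_inf' _ _ fun h _ => hg h) (Finset.inf'_le _ (Finset.mem_univ g))
  have exists_antitone : ∀ g : Equiv.Perm (Fin 6),
      (∀ h : Equiv.Perm (Fin 6), avgd (p ∘ g) ≤ avgd (p ∘ h)) →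
      ∃ r, Antitone (p ∘ ⇑(g * (dihedral r * organPipe))) := by
    intro g hg
    obtain ⟨k, hk⟩ := Finite.exists_max (p ∘ g)
    have key : ∀ r, dihedral r 0 = k → p (g (dihedral r 5)) ≤ p (g (dihedral r 1)) →
        ∃ r, Antitone (p ∘ ⇑(g * (dihedral r * organPipe))) := by
      refine fun r hr h => ⟨r, antitone_comp_organPipe (f := p ∘ g ∘ dihedral r)
        (fun i => hp0 _) (fun i j hi hj hij => hdist _ _ hi hj (by simpa using hij))
        (fun σ => ?_) ?_ (fun i => ?_) h⟩
      · rw [← Function.comp_assoc, avgd_comp_dihedral]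
        exact hg (g * (dihedral r * σ))
      · obtain ⟨i, hi⟩ := hpos
        have := hk (g.symm i)
        simp only [Function.comp_apply, Equiv.apply_symm_apply] at this
        simp only [Function.comp_apply, hr]
        linarith
      · simpa only [Function.comp_apply, hr] using hk (dihedral r i)
    rcases le_total (p (g (k + 5))) (p (g (k + 1))) with h | h
    · exact key (true, k) (by simp [dihedral]) (by simpa [dihedral] using h)
    · refine key (false, k) (by simp [dihedral]) ?_
      have h1 : k - 1 = k + 5 := sub_eq_add_neg k 1
      have h5 : k - 5 = k + 1 := sub_eq_add_neg k 5
      simpa [dihedral, h1, h5] using h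
  have second_ne_zero : ∀ h : Equiv.Perm (Fin 6), Antitone (p ∘ h) → p (h 1) ≠ 0 := by
    intro h hh h1
    have hsub : (Finset.univ.filter fun i => p i ≠ 0) ⊆ {h 0} := by
      intro i hi
      rw [Finset.mem_filter] at hi
      by_contra hne
      have hi0 : h.symm i ≠ 0 := fun h' => hne (by simp [← h'])
      have : p (h (h.symm i)) ≤ p (h 1) := hh (Fin.one_le_of_ne_zero hi0)
      rw [Equiv.apply_symm_apply, h1] at this
      exact hi.2 (le_antisymm this (hp0 i))
    have := Finset.card_le_card hsub
    rw [Finset.card_singleton] at this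
    omega
  have first_ne_zero : ∀ h : Equiv.Perm (Fin 6), Antitone (p ∘ h) → p (h 0) ≠ 0 := by
    intro h hh h0
    have : p (h 1) ≤ p (h 0) := hh (Fin.zero_le 1)
    exact second_ne_zero h hh (le_antisymm (h0 ▸ this) (hp0 _))
  have avgd_eq_of_antitone : ∀ (g g' : Equiv.Perm (Fin 6)) (r s : Bool × Fin 6),
      Antitone (p ∘ ⇑(g * (dihedral r * organPipe))) →
      Antitone (p ∘ ⇑(g' * (dihedral s * organPipe))) → avgd (p ∘ g) = avgd (p ∘ g') := by
    intro g g' r s hg hg'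
    have := Tuple.unique_antitone hg hg'
    rw [← avgd_comp_dihedral (p ∘ g) r, ← avgd_comp_dihedral (p ∘ g') s]
    congr 1
    funext i
    simpa using congrFun this (organPipe⁻¹ i)
  obtain ⟨g₀, hg₀⟩ := Finite.exists_min fun g : Equiv.Perm (Fin 6) => avgd (p ∘ g)
  obtain ⟨r₀, hr₀⟩ := exists_antitone g₀ hg₀
  have hcard : (Finset.univ ×ˢ Finset.univ.filter fun h : Equiv.Perm (Fin 6) =>
      Antitone (p ∘ h) : Finset ((Bool × Fin 6) × Equiv.Perm (Fin 6))).card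
      = 12 * Nat.factorial (6 - m) := by
    rw [Finset.card_product, card_antitone_comp hdist, hm]
    rfl
  rw [← hcard]
  symm
  refine Finset.card_bij (fun x _ => x.2 * (dihedral x.1 * organPipe)⁻¹) ?_ ?_ ?_
  · rintro ⟨r, h⟩ hx
    simp only [Finset.mem_product, Finset.mem_filter, Finset.mem_univ, true_and] at hx ⊢
    rw [mem_iff, avgd_eq_of_antitone _ g₀ r r₀ (by rwa [inv_mul_cancel_right]) hr₀]
    exact hg₀
  · rintro ⟨r, h⟩ hx ⟨s, h'⟩ hx' heq
    simp only [Finset.mem_product, Finset.mem_filter, Finset.mem_univ, true_and] at hx hx' heq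
    have hpp := Tuple.unique_antitone hx hx'
    rw [mul_inv_eq_iff_eq_mul] at heq
    set g := h' * (dihedral s * organPipe)⁻¹ with hg
    have hh' : h' = g * (dihedral s * organPipe) := by rw [hg, inv_mul_cancel_right]
    have hval : ∀ i, p (h i) ≠ 0 → dihedral r (organPipe i) = dihedral s (organPipe i) := by
      intro i hi
      have hi' : p (h i) = p (h' i) := congrFun hpp i
      have hii : h i = h' i := by
        by_contra hne
        exact hdist _ _ hi (hi' ▸ hi) hne hi'
      rw [heq, hh'] at hii
      exact g.injective hii
    have hrs := dihedral_eq_of_apply_organPipe r s (hval 0 (first_ne_zero h hx))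
      (hval 1 (second_ne_zero h hx))
    rw [hrs, ← hh'] at heq
    rw [hrs, heq]
  · intro g hg
    rw [Finset.mem_filter, mem_iff] at hg
    obtain ⟨r, hr⟩ := exists_antitone g hg.2
    refine ⟨(r, g * (dihedral r * organPipe)), ?_, mul_inv_cancel_right _ _⟩
    simpa only [Finset.mem_product, Finset.mem_filter, Finset.mem_univ, true_and] using hr
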